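/- arXiv:1709.05985 — 2 statements merged into one kernel-verified Lean document; each statement's English description precedes it below -/
import Mathlib

section
/- Let k be an infinite field and let d = 2s+1 be odd with d ≥ 2 (so s ≥ 1). For general forms f₁, f₂, f₃ of degree d in R = k[x,y], setting I = (f₁, f₂, f₃), one has dim_k (R/I)_{3s} = 1 and dim_k (R/I)_{3s+1} = 0, where (R/I)_j denotes the degree-j graded piece of R/I. -/
open MvPolynomial

noncomputable section

/-- The binary form of degree `d` in `k[x,y]` with coefficient vector `c`
(`x := X 0`, `y := X 1`). -/
def formOf {k : Type*} [Field k] (d : ℕ) (c : Fin (d + 1) → k) :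
    MvPolynomial (Fin 2) k :=
  ∑ l : Fin (d + 1), C (c l) * X 0 ^ (l : ℕ) * X 1 ^ (d - (l : ℕ))

/-- The degree-`j` graded piece of `R/I`, `R = k[x,y]`: the image of the homogeneous
polynomials of degree `j` in the quotient, as a `k`-vector space. -/
def quotPiece {k : Type*} [Field k] (I : Ideal (MvPolynomial (Fin 2) k)) (j : ℕ) :
    Submodule k (MvPolynomial (Fin 2) k ⧸ I) :=
  Submodule.map (Ideal.Quotient.mkₐ k I).toLinearMap (homogeneousSubmodule (Fin 2) k j)

theorem homogeneousComponent_add_mul {σ S : Type*} [CommSemiring S] {d : ℕ}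
    {f : MvPolynomial σ S} (hf : f.IsHomogeneous d) (m : ℕ) (u : MvPolynomial σ S) :
    homogeneousComponent (m + d) (u * f) = homogeneousComponent m u * f := by
  let _ := gradedAlgebra (σ := σ) (R := S)
  have h := DirectSum.coe_decompose_mul_of_right_mem_of_le (homogeneousSubmodule σ S)
    (a := u) ((mem_homogeneousSubmodule d f).2 hf) (Nat.le_add_left d m)
  rw [Nat.add_sub_cancel] at h
  rw [← decomposition.decompose'_apply, ← decomposition.decompose'_apply]
  exact h

/-- The exponent vector of `x ^ l * y ^ (n - l)`. -/
def binaryExponent (n l : ℕ) : Fin 2 →₀ ℕ :=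
  Finsupp.single 0 l + Finsupp.single 1 (n - l)

theorem binaryExponent_eq_iff {n l : ℕ} (hl : l ≤ n) {m : Fin 2 →₀ ℕ} :
    binaryExponent n l = m ↔ m.degree = n ∧ l = m 0 := by
  rw [Finsupp.ext_iff, Fin.forall_fin_two, Finsupp.degree_eq_sum]
  simp [binaryExponent]
  lia

section

variable {k : Type*} [Field k]

theorem formOf_eq_sum_monomial (n : ℕ) (c : Fin (n + 1) → k) :
    formOf n c = ∑ l : Fin (n + 1), monomial (binaryExponent n l) (c l) := by
  refine Finset.sum_congr rfl fun l _ => ?_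
  rw [binaryExponent, mul_assoc, X_pow_eq_monomial, X_pow_eq_monomial, monomial_mul,
    C_mul_monomial]
  simp

theorem formOf_isHomogeneous (n : ℕ) (c : Fin (n + 1) → k) : (formOf n c).IsHomogeneous n := by
  rw [formOf_eq_sum_monomial]
  refine IsHomogeneous.sum _ _ _ fun l _ => isHomogeneous_monomial _ ?_
  exact ((binaryExponent_eq_iff l.is_le).1 rfl).1

theorem coeff_formOf (n : ℕ) (c : Fin (n + 1) → k) (l : Fin (n + 1)) :
    coeff (binaryExponent n l) (formOf n c) = c l := by
  classical
  have h (i : Fin (n + 1)) : binaryExponent n i = binaryExponent n l ↔ i = l := by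
    have hl := (binaryExponent_eq_iff l.is_le).1 (Eq.refl (binaryExponent n l))
    rw [binaryExponent_eq_iff i.is_le, ← hl.2, Fin.ext_iff]
    exact and_iff_right hl.1
  simp [formOf_eq_sum_monomial, coeff_sum, coeff_monomial, h]

theorem formOf_coeff {n : ℕ} {h : MvPolynomial (Fin 2) k} (hh : h.IsHomogeneous n) :
    formOf n (fun l => coeff (binaryExponent n l) h) = h := by
  ext m
  by_cases hm : m.degree = n
  · have hlt : m 0 < n + 1 := by
      rw [Finsupp.degree_eq_sum, Fin.sum_univ_two] at hm
      lia
    rw [← (binaryExponent_eq_iff (Nat.le_of_lt_succ hlt)).2 ⟨hm, rfl⟩]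
    exact coeff_formOf n _ ⟨m 0, hlt⟩
  · rw [(formOf_isHomogeneous n _).coeff_eq_zero hm, hh.coeff_eq_zero hm]

/-- `formOf` as a linear map in the coefficient vector. -/
def formOfLin (k : Type*) [Field k] (n : ℕ) :
    (Fin (n + 1) → k) →ₗ[k] MvPolynomial (Fin 2) k where
  toFun := formOf n
  map_add' c e := by simp [formOf_eq_sum_monomial, Finset.sum_add_distrib]
  map_smul' a c := by simp [formOf_eq_sum_monomial, Finset.smul_sum, smul_monomial]

theorem formOf_injective (n : ℕ) : Function.Injective (formOf (k := k) n) := fun c e h =>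
  funext fun l => by rw [← coeff_formOf n c, h, coeff_formOf]

theorem range_formOfLin (n : ℕ) :
    LinearMap.range (formOfLin k n) = homogeneousSubmodule (Fin 2) k n := by
  ext h
  constructor
  · rintro ⟨c, rfl⟩
    exact formOf_isHomogeneous n c
  · exact fun hh => ⟨_, formOf_coeff hh⟩

end

/-- The matrix of `(g_t) ↦ ∑ t, f_t * g_t` from triples of binary forms of degree `m` to binary
forms of degree `d + m`, where `f_t` has degree `d` and coefficient vector `c t`. -/
def mulMatrix {S : Type*} [CommSemiring S] (d m : ℕ) (c : Fin 3 → Fin (d + 1) → S) :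
    Matrix (Fin (d + m + 1)) (Fin 3 × Fin (m + 1)) S :=
  Matrix.of fun a p => ∑ l : Fin (d + 1), if (l : ℕ) + p.2 = a then c p.1 l else 0

theorem map_mulMatrix {S T : Type*} [CommSemiring S] [CommSemiring T] (φ : S →+* T) (d m : ℕ)
    (c : Fin 3 → Fin (d + 1) → S) :
    (mulMatrix d m c).map φ = mulMatrix d m fun t l => φ (c t l) := by
  ext a p
  simp [mulMatrix, map_sum, apply_ite φ]

theorem mulMatrix_monomials {S : Type*} [CommSemiring S] (d m : ℕ) (e : Fin 3 → Fin (d + 1))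
    (a : Fin (d + m + 1)) (p : Fin 3 × Fin (m + 1)) :
    mulMatrix d m (fun t => Pi.single (e t) (1 : S)) a p =
      if (e p.1 : ℕ) + p.2 = a then 1 else 0 := by
  rw [mulMatrix, Matrix.of_apply, Finset.sum_eq_single (e p.1)]
  · simp
  · intro l _ hl
    simp [hl]
  · simp

section

variable {k : Type*} [Field k]

theorem sum_formOf_mul_formOf (d m : ℕ) (c : Fin 3 → Fin (d + 1) → k)
    (g : Fin 3 × Fin (m + 1) → k) :
    ∑ t, formOf m (fun i => g (t, i)) * formOf d (c t) =
      formOf (d + m) ((mulMatrix d m c).mulVec g) := by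
  have key (l : Fin (d + 1)) (i : Fin (m + 1)) (r : k) :
      ∑ a : Fin (d + m + 1), monomial (binaryExponent (d + m) a)
        (if (l : ℕ) + i = a then r else 0) =
      monomial (binaryExponent m i + binaryExponent d l) r := by
    have hlt : (l : ℕ) + i < d + m + 1 := by lia
    rw [Finset.sum_eq_single ⟨(l : ℕ) + i, hlt⟩]
    · simp only [if_true]
      refine congrArg (fun b => monomial b r) (Finsupp.ext fun j => ?_)
      fin_cases j <;> simp [binaryExponent] <;> lia
    · intro a _ ha
      rw [if_neg (fun h => ha (Fin.ext h.symm)), map_zero]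
    · simp
  simp only [formOf_eq_sum_monomial, Matrix.mulVec, dotProduct, mulMatrix, Matrix.of_apply,
    Finset.sum_mul, Finset.mul_sum, map_sum, monomial_mul, Fintype.sum_prod_type, ite_mul, zero_mul]
  symm
  rw [Finset.sum_comm]
  refine Finset.sum_congr rfl fun t _ => ?_
  rw [Finset.sum_comm, Finset.sum_comm (s := (Finset.univ : Finset (Fin (d + 1))))]
  refine Finset.sum_congr rfl fun i _ => ?_
  rw [Finset.sum_comm]
  refine Finset.sum_congr rfl fun l _ => ?_
  rw [key, mul_comm]

theorem formOf_mem_span_iff (d m : ℕ) (c : Fin 3 → Fin (d + 1) → k) (v : Fin (d + m + 1) → k) :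
    formOf (d + m) v ∈ Ideal.span (Set.range fun t => formOf d (c t)) ↔
      v ∈ LinearMap.range (mulMatrix d m c).mulVecLin := by
  rw [Ideal.mem_span_range_iff_exists_fun]
  constructor
  · rintro ⟨u, hu⟩
    refine ⟨fun p => coeff (binaryExponent m p.2) (homogeneousComponent m (u p.1)), ?_⟩
    refine formOf_injective (d + m) ?_
    rw [Matrix.mulVecLin_apply, ← sum_formOf_mul_formOf,
      ← homogeneousComponent_eq_self (formOf_isHomogeneous (d + m) v), ← hu, map_sum]
    refine Finset.sum_congr rfl fun t _ => ?_
    rw [formOf_coeff (homogeneousComponent_isHomogeneous m (u t))]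
    rw [Nat.add_comm d m, homogeneousComponent_add_mul (formOf_isHomogeneous d (c t))]
  · rintro ⟨g, rfl⟩
    exact ⟨fun t => formOf m fun i => g (t, i), sum_formOf_mul_formOf d m c g⟩

theorem finrank_quotPiece_add_rank (d m : ℕ) (c : Fin 3 → Fin (d + 1) → k) :
    Module.finrank k (quotPiece (Ideal.span (Set.range fun t => formOf d (c t))) (d + m)) +
      (mulMatrix d m c).rank = d + m + 1 := by
  set I := Ideal.span (Set.range fun t => formOf d (c t))
  let q := (Ideal.Quotient.mkₐ k I).toLinearMap ∘ₗ formOfLin k (d + m)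
  have hker : LinearMap.ker q = LinearMap.range (mulMatrix d m c).mulVecLin := by
    ext v
    exact Ideal.Quotient.eq_zero_iff_mem.trans (formOf_mem_span_iff d m c v)
  have hrange : quotPiece I (d + m) = LinearMap.range q := by
    rw [quotPiece, LinearMap.range_comp, range_formOfLin]
  rw [Matrix.rank, ← hker, hrange, LinearMap.finrank_range_add_finrank_ker]
  simp

end

section

variable {k : Type*} [Field k]

/-- A maximal minor of `mulMatrix` with generic entries, which specializes to `1` at the monomials
`x ^ e t * y ^ (d - e t)`, witnesses that the rank is generically at least its size. -/
theorem exists_minor_le_rank_mulMatrix {ι : Type*} [Fintype ι] [DecidableEq ι] {d m : ℕ}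
    (e : Fin 3 → Fin (d + 1)) {r : ι → Fin (d + m + 1)} (hr : Function.Injective r)
    (q : ι → Fin 3 × Fin (m + 1)) (h : ∀ i, (e (q i).1 : ℕ) + (q i).2 = r i) :
    ∃ P : MvPolynomial (Fin 3 × Fin (d + 1)) k,
      eval (fun p => Pi.single (M := fun _ => k) (e p.1) 1 p.2) P = 1 ∧
      ∀ c : Fin 3 → Fin (d + 1) → k, eval (fun p => c p.1 p.2) P ≠ 0 →
        Fintype.card ι ≤ (mulMatrix d m c).rank := by
  have heval (c : Fin 3 → Fin (d + 1) → k) :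
      eval (fun p => c p.1 p.2)
        ((mulMatrix d m fun t l => (X (t, l) : MvPolynomial _ k)).submatrix r q).det =
      ((mulMatrix d m c).submatrix r q).det := by
    rw [RingHom.map_det, RingHom.mapMatrix_apply, ← Matrix.submatrix_map, map_mulMatrix]
    simp
  refine ⟨((mulMatrix d m fun t l => X (t, l)).submatrix r q).det, ?_, fun c hc => ?_⟩
  · rw [heval fun t => Pi.single (e t) 1]
    refine (congrArg Matrix.det (Matrix.ext fun i j => ?_)).trans Matrix.det_one
    rw [Matrix.submatrix_apply, mulMatrix_monomials, h, Matrix.one_apply]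
    simp only [Fin.val_inj, hr.eq_iff, eq_comm]
  · rw [heval] at hc
    rw [← Matrix.rank_of_isUnit _ ((Matrix.isUnit_iff_isUnit_det _).2 hc.isUnit)]
    exact Matrix.rank_submatrix_le _ _ _

end

/-- The exponents of `x` in `x ^ (2 * s + 1)`, `y ^ (2 * s + 1)`, `x ^ s * y ^ (s + 1)`. -/
def witnessExponent (s : ℕ) : Fin 3 → Fin (2 * s + 1 + 1) :=
  ![Fin.last _, 0, ⟨s, by lia⟩]

theorem exists_minor_degree_three_mul (k : Type*) [Field k] (m : ℕ) :
    ∃ P : MvPolynomial (Fin 3 × Fin (2 * (m + 1) + 1 + 1)) k,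
      eval (fun p => Pi.single (M := fun _ => k) (witnessExponent (m + 1) p.1) 1 p.2) P = 1 ∧
      ∀ c : Fin 3 → Fin (2 * (m + 1) + 1 + 1) → k, eval (fun p => c p.1 p.2) P ≠ 0 →
        3 * (m + 1) ≤ (mulMatrix (2 * (m + 1) + 1) m c).rank := by
  have hinj : Function.Injective fun p : Fin 3 × Fin (m + 1) =>
      (⟨witnessExponent (m + 1) p.1 + p.2, by lia⟩ : Fin (2 * (m + 1) + 1 + m + 1)) := by
    rintro ⟨t, i⟩ ⟨u, j⟩ h
    rw [Fin.mk.injEq] at h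
    rw [Prod.mk.injEq, Fin.ext_iff, Fin.ext_iff]
    fin_cases t <;> fin_cases u <;> simp [witnessExponent] at h ⊢ <;> lia
  simpa using exists_minor_le_rank_mulMatrix (k := k) (witnessExponent (m + 1)) hinj id fun _ => rfl

theorem exists_minor_degree_three_mul_add_one (k : Type*) [Field k] (s : ℕ) :
    ∃ P : MvPolynomial (Fin 3 × Fin (2 * s + 1 + 1)) k,
      eval (fun p => Pi.single (M := fun _ => k) (witnessExponent s p.1) 1 p.2) P = 1 ∧
      ∀ c : Fin 3 → Fin (2 * s + 1 + 1) → k, eval (fun p => c p.1 p.2) P ≠ 0 →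
        2 * s + 1 + s + 1 ≤ (mulMatrix (2 * s + 1) s c).rank := by
  have hsurj (a : Fin (2 * s + 1 + s + 1)) :
      ∃ p : Fin 3 × Fin (s + 1), (witnessExponent s p.1 : ℕ) + p.2 = a := by
    by_cases h1 : (a : ℕ) ≤ s
    · exact ⟨(1, ⟨a, by lia⟩), by simp [witnessExponent]⟩
    by_cases h2 : (a : ℕ) ≤ 2 * s
    · exact ⟨(2, ⟨a - s, by lia⟩), by simp [witnessExponent]; lia⟩
    · exact ⟨(0, ⟨a - (2 * s + 1), by lia⟩), by simp [witnessExponent]; lia⟩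
  choose q hq using hsurj
  simpa using
    exists_minor_le_rank_mulMatrix (k := k) (witnessExponent s) Function.injective_id q hq

/-- For an infinite field `k` and odd `d = 2s+1 ≥ 2`, for general forms `f₁, f₂, f₃` of
degree `d` in `R = k[x,y]` (genericity encoded as the nonvanishing locus of a nonzero
polynomial on the parameter space `k^{3(d+1)}`), with `I = (f₁,f₂,f₃)`, one has
`dim_k (R/I)_{3s} = 1` and `dim_k (R/I)_{3s+1} = 0`. -/
theorem general_binary_forms_odd_socle (k : Type*) [Field k] [Infinite k]
    (s d : ℕ) (hs : 1 ≤ s) (hd : d = 2 * s + 1) :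
    ∃ P : MvPolynomial (Fin 3 × Fin (d + 1)) k, P ≠ 0 ∧
      ∀ c : Fin 3 → Fin (d + 1) → k,
        eval (fun p => c p.1 p.2) P ≠ 0 →
          Module.finrank k
            (quotPiece (Ideal.span {formOf d (c 0), formOf d (c 1), formOf d (c 2)}) (3 * s)) = 1 ∧
          Module.finrank k
            (quotPiece (Ideal.span {formOf d (c 0), formOf d (c 1), formOf d (c 2)})
              (3 * s + 1)) = 0 := by
  subst hd
  obtain ⟨m, rfl⟩ := Nat.exists_eq_succ_of_ne_zero (Nat.one_le_iff_ne_zero.1 hs)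
  obtain ⟨P, hP, hPrank⟩ := exists_minor_degree_three_mul k m
  obtain ⟨Q, hQ, hQrank⟩ := exists_minor_degree_three_mul_add_one k (m + 1)
  refine ⟨P * Q, fun h => ?_, fun c hc => ?_⟩
  · have := congrArg
      (eval fun p => Pi.single (M := fun _ => k) (witnessExponent (m + 1) p.1) 1 p.2) h
    rw [map_mul, hP, hQ, map_zero, mul_one] at this
    exact one_ne_zero this
  rw [map_mul] at hc
  have hspan : ({formOf _ (c 0), formOf _ (c 1), formOf _ (c 2)} : Set (MvPolynomial (Fin 2) k)) =
      Set.range fun t => formOf _ (c t) := by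
    ext f
    simp [Fin.exists_fin_succ, eq_comm]
  rw [hspan, show 3 * (m + 1) = 2 * (m + 1) + 1 + m by ring,
    show 2 * (m + 1) + 1 + m + 1 = 2 * (m + 1) + 1 + (m + 1) by ring]
  have h₁ := finrank_quotPiece_add_rank _ m c
  have h₂ := finrank_quotPiece_add_rank _ (m + 1) c
  have h₃ := hPrank c (left_ne_zero_of_mul hc)
  have h₄ := hQrank c (right_ne_zero_of_mul hc)
  have h₅ := (mulMatrix _ m c).rank_le_card_width
  rw [Fintype.card_prod, Fintype.card_fin, Fintype.card_fin] at h₅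
  lia
end
end

section
/- Let k be an infinite field of characteristic ≠ 2 and let d = 2s+1 be odd with d ≥ 5 (so s ≥ 2). For general forms f₁, f₂, f₃ of degree d in R = k[x,y], setting I = (f₁, f₂, f₃), one has y^{3s}·I ⊆ I², i.e., y^{3s}·f_j ∈ I² for j = 1, 2, 3. -/
open MvPolynomial

noncomputable section

/-- If the vectors `e b` lie in the span of the family `∑ b, M j b • e b` for one value of the
parameters on which the entries of `M` depend polynomially, then they do for general values. -/
theorem exists_ne_zero_forall_mem_span {k V σ ι J : Type*} [Field k] [AddCommGroup V] [Module k V]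
    [Fintype ι] [DecidableEq ι] [Fintype J] {e : ι → V} (he : LinearIndependent k e)
    (M : Matrix J ι (MvPolynomial σ k)) (c₀ : σ → k)
    (h₀ : ∀ b, e b ∈ Submodule.span k (Set.range fun j => ∑ b, eval c₀ (M j b) • e b)) :
    ∃ P : MvPolynomial σ k, P ≠ 0 ∧ ∀ c : σ → k, eval c P ≠ 0 →
      ∀ b, e b ∈ Submodule.span k (Set.range fun j => ∑ b, eval c (M j b) • e b) := by
  simp only [Submodule.mem_span_range_iff_exists_fun] at h₀
  choose N hN using h₀
  have hmul (c : σ → k) (L : Matrix ι J k) (a : ι) :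
      ∑ j, L a j • ∑ b, eval c (M j b) • e b = ∑ b, (L * M.map (eval c)) a b • e b := by
    simp only [Finset.smul_sum, Matrix.mul_apply, Finset.sum_smul, smul_smul, Matrix.map_apply]
    exact Finset.sum_comm
  have hdet (c : σ → k) : eval c (Matrix.det (Matrix.of fun a b => ∑ j, C (N a j) * M j b)) =
      Matrix.det (Matrix.of N * M.map (eval c)) := by
    rw [RingHom.map_det]
    congr 1
    ext a j
    simp [Matrix.mul_apply]
  refine ⟨Matrix.det (Matrix.of fun a b => ∑ j, C (N a j) * M j b), ?_, fun c hc b => ?_⟩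
  · intro h
    have hone : Matrix.of N * M.map (eval c₀) = 1 := by
      ext a b
      have h1 : ∑ b, (Matrix.of N * M.map (eval c₀)) a b • e b
          = ∑ b, (1 : Matrix ι ι k) a b • e b := by
        rw [← hmul]
        simpa [Matrix.one_apply] using hN a
      rw [← sub_eq_zero, ← Finset.sum_sub_distrib] at h1
      simp only [← sub_smul] at h1
      exact sub_eq_zero.mp (Fintype.linearIndependent_iff.mp he _ h1 b)
    have h1 := hdet c₀
    rw [h, hone] at h1
    simp at h1
  · rw [hdet] at hc
    set A := Matrix.of N * M.map (eval c) with hA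
    have hinv : A⁻¹ * A = 1 := Matrix.nonsing_inv_mul _ (isUnit_iff_ne_zero.mpr hc)
    rw [Submodule.mem_span_range_iff_exists_fun]
    refine ⟨(A⁻¹ * Matrix.of N) b, ?_⟩
    rw [hmul, Matrix.mul_assoc, ← hA, hinv]
    simp [Matrix.one_apply]

/-- The products of two of the forms `f` with a monomial of degree `s - 1`. -/
def squareMultiple {k : Type*} [Field k] (s : ℕ) (f : Fin 3 → MvPolynomial (Fin 2) k)
    (j : Fin 3 × Fin 3 × Fin s) : MvPolynomial (Fin 2) k :=
  X 0 ^ (j.2.2 : ℕ) * X 1 ^ (s - 1 - j.2.2) * (f j.1 * f j.2.1)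

/-- The coefficients of `squareMultiple` as polynomials in the coefficients of the forms. -/
def squareMultipleCoeff (k : Type*) [Field k] (s : ℕ) :
    Matrix (Fin 3 × Fin 3 × Fin s) (Fin (5 * s + 2))
      (MvPolynomial (Fin 3 × Fin (2 * s + 1 + 1)) k) :=
  fun j b => ∑ l : Fin (2 * s + 1 + 1), ∑ m : Fin (2 * s + 1 + 1),
    if (j.2.2 + l + m : ℕ) = b then X (j.1, l) * X (j.2.1, m) else 0

/-- The monomial of degree `5 * s + 1` and of degree `a` in the first variable. -/
def binaryMonomial (k : Type*) [Field k] (s a : ℕ) : MvPolynomial (Fin 2) k :=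
  X 0 ^ a * X 1 ^ (5 * s + 1 - a)

theorem linearIndependent_binaryMonomial (k : Type*) [Field k] (s : ℕ) :
    LinearIndependent k fun b : Fin (5 * s + 2) => binaryMonomial k s b := by
  have h := (basisMonomials (Fin 2) k).linearIndependent.comp
    (fun b : Fin (5 * s + 2) =>
      Finsupp.single (0 : Fin 2) (b : ℕ) + Finsupp.single 1 (5 * s + 1 - b)) (by
        intro a b hab
        have h0 := DFunLike.congr_fun hab 0
        simp at h0
        exact Fin.ext h0)
  have hfun : (fun b : Fin (5 * s + 2) => binaryMonomial k s b) =
      basisMonomials (Fin 2) k ∘ fun b : Fin (5 * s + 2) =>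
        Finsupp.single (0 : Fin 2) (b : ℕ) + Finsupp.single 1 (5 * s + 1 - b) := by
    funext b
    simp [binaryMonomial, X_pow_eq_monomial, monomial_mul]
  rw [hfun]
  exact h

theorem squareMultiple_formOf {k : Type*} [Field k] {s : ℕ} (c : Fin 3 → Fin (2 * s + 1 + 1) → k)
    (j : Fin 3 × Fin 3 × Fin s) :
    squareMultiple s (fun p => formOf (2 * s + 1) (c p)) j =
      ∑ b : Fin (5 * s + 2),
        eval (fun p => c p.1 p.2) (squareMultipleCoeff k s j b) • binaryMonomial k s b := by
  obtain ⟨p, q, i⟩ := j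
  have hi := i.2
  simp only [squareMultiple, squareMultipleCoeff, formOf, map_sum, Finset.sum_smul,
    Finset.sum_mul_sum]
  symm
  rw [Finset.sum_comm, Finset.mul_sum]
  refine Finset.sum_congr rfl fun l _ => ?_
  rw [Finset.sum_comm, Finset.mul_sum]
  refine Finset.sum_congr rfl fun m _ => ?_
  have hl := l.2
  have hm := m.2
  rw [Finset.sum_eq_single ⟨i + l + m, by omega⟩]
  · have hexp : 5 * s + 1 - (i + l + m : ℕ) =
        (s - 1 - i) + (2 * s + 1 - l) + (2 * s + 1 - m) := by omega
    simp only [binaryMonomial, hexp, if_true, smul_eq_C_mul, map_mul, eval_X]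
    ring
  · intro b _ hb
    rw [if_neg fun h => hb (Fin.ext h.symm)]
    simp
  · simp

/-- The coefficients of `x ^ (2 * s + 1)`, `x ^ s * y ^ (s + 1)` and
`y ^ (2 * s + 1) - x ^ (2 * s) * y`. -/
def specialCoeff (k : Type*) [Field k] (s : ℕ) : Fin 3 → Fin (2 * s + 1 + 1) → k :=
  ![Pi.single ⟨2 * s + 1, by omega⟩ 1, Pi.single ⟨s, by omega⟩ 1,
    Pi.single ⟨0, by omega⟩ 1 - Pi.single ⟨2 * s, by omega⟩ 1]

theorem formOf_single {k : Type*} [Field k] (d : ℕ) (l : Fin (d + 1)) :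
    formOf d (Pi.single l (1 : k)) = X 0 ^ (l : ℕ) * X 1 ^ (d - l) := by
  rw [formOf, Finset.sum_eq_single l]
  · simp
  · intro b _ hb
    simp [hb]
  · simp

theorem formOf_sub {k : Type*} [Field k] (d : ℕ) (a b : Fin (d + 1) → k) :
    formOf d (a - b) = formOf d a - formOf d b := by
  simp [formOf, sub_mul]

theorem formOf_specialCoeff (k : Type*) [Field k] (s : ℕ) :
    (fun p => formOf (2 * s + 1) (specialCoeff k s p)) =
      ![X 0 ^ (2 * s + 1), X 0 ^ s * X 1 ^ (s + 1),
        X 1 ^ (2 * s + 1) - X 0 ^ (2 * s) * X 1] := by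
  have h : 2 * s + 1 - s = s + 1 := by omega
  funext p
  fin_cases p <;> simp [specialCoeff, formOf_single, formOf_sub, h]

theorem binaryMonomial_mem_span_special (k : Type*) [Field k] {s : ℕ} (hs : 2 ≤ s) {a : ℕ}
    (ha : a < 5 * s + 2) :
    binaryMonomial k s a ∈ Submodule.span k (Set.range
      (squareMultiple s fun p => formOf (2 * s + 1) (specialCoeff k s p))) := by
  rw [formOf_specialCoeff]
  set f : Fin 3 → MvPolynomial (Fin 2) k := ![X 0 ^ (2 * s + 1), X 0 ^ s * X 1 ^ (s + 1),
    X 1 ^ (2 * s + 1) - X 0 ^ (2 * s) * X 1] with hf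
  set W := Submodule.span k (Set.range (squareMultiple s f))
  have hW (p q : Fin 3) (i : ℕ) (hi : i < s) :
      X 0 ^ i * X 1 ^ (s - 1 - i) * (f p * f q) ∈ W :=
    Submodule.subset_span ⟨(p, q, ⟨i, hi⟩), rfl⟩
  have h00 (i : ℕ) (hi : i < s) : binaryMonomial k s (4 * s + 2 + i) ∈ W := by
    convert hW 0 0 i hi using 1
    have h : 5 * s + 1 - (4 * s + 2 + i) = s - 1 - i := by omega
    simp only [binaryMonomial, hf, h, Matrix.cons_val]
    ring
  have h01 (i : ℕ) (hi : i < s) : binaryMonomial k s (3 * s + 1 + i) ∈ W := by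
    convert hW 0 1 i hi using 1
    have h : 5 * s + 1 - (3 * s + 1 + i) = s - 1 - i + (s + 1) := by omega
    simp only [binaryMonomial, hf, h, Matrix.cons_val]
    ring
  have h11 (i : ℕ) (hi : i < s) : binaryMonomial k s (2 * s + i) ∈ W := by
    convert hW 1 1 i hi using 1
    have h : 5 * s + 1 - (2 * s + i) = s - 1 - i + (2 * s + 2) := by omega
    simp only [binaryMonomial, hf, h, Matrix.cons_val]
    ring
  have h02 (i : ℕ) (hi : i < s) :
      binaryMonomial k s (2 * s + 1 + i) - binaryMonomial k s (4 * s + 1 + i) ∈ W := by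
    convert hW 0 2 i hi using 1
    have h : 5 * s + 1 - (2 * s + 1 + i) = s - 1 - i + (2 * s + 1) := by omega
    have h' : 5 * s + 1 - (4 * s + 1 + i) = s - 1 - i + 1 := by omega
    simp only [binaryMonomial, hf, h, h', Matrix.cons_val]
    ring
  have h12 (i : ℕ) (hi : i < s) :
      binaryMonomial k s (s + i) - binaryMonomial k s (3 * s + i) ∈ W := by
    convert hW 1 2 i hi using 1
    have h : 5 * s + 1 - (s + i) = s - 1 - i + (3 * s + 2) := by omega
    have h' : 5 * s + 1 - (3 * s + i) = s - 1 - i + (s + 2) := by omega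
    simp only [binaryMonomial, hf, h, h', Matrix.cons_val]
    ring
  have h22 (i : ℕ) (hi : i < s) :
      binaryMonomial k s i - (2 : k) • binaryMonomial k s (2 * s + i)
        + binaryMonomial k s (4 * s + i) ∈ W := by
    convert hW 2 2 i hi using 1
    have h : 5 * s + 1 - i = s - 1 - i + (4 * s + 2) := by omega
    have h' : 5 * s + 1 - (2 * s + i) = s - 1 - i + (2 * s + 2) := by omega
    have h4 : 5 * s + 1 - (4 * s + i) = s - 1 - i + 2 := by omega
    simp only [binaryMonomial, hf, h, h', h4, Matrix.cons_val, smul_eq_C_mul, map_ofNat]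
    ring
  have h3s : binaryMonomial k s (3 * s) ∈ W := by
    have h := h02 (s - 1) (by omega)
    rw [show 2 * s + 1 + (s - 1) = 3 * s by omega] at h
    refine (Submodule.sub_mem_iff_left W ?_).mp h
    convert h00 (s - 2) (by omega) using 2
    omega
  have h4s : binaryMonomial k s (4 * s + 1) ∈ W := by
    refine (Submodule.sub_mem_iff_right W ?_).mp (h02 0 (by omega))
    exact h11 1 (by omega)
  have hhigh (b : ℕ) (hb : 2 * s ≤ b) (hb' : b < 5 * s + 2) : binaryMonomial k s b ∈ W := by
    rcases lt_or_ge b (3 * s) with h | h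
    · convert h11 (b - 2 * s) (by omega) using 2
      omega
    rcases h.eq_or_lt with rfl | h
    · exact h3s
    rcases lt_or_ge b (4 * s + 1) with h | h
    · convert h01 (b - (3 * s + 1)) (by omega) using 2
      omega
    rcases h.eq_or_lt with rfl | h
    · exact h4s
    · convert h00 (b - (4 * s + 2)) (by omega) using 2
      omega
  rcases lt_or_ge a s with h | h
  · have h1 := (Submodule.add_mem_iff_left W (hhigh _ (by omega) (by omega))).mp (h22 a h)
    exact (Submodule.sub_mem_iff_left W
      (W.smul_mem _ (hhigh _ (by omega) (by omega)))).mp h1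
  rcases lt_or_ge a (2 * s) with h' | h'
  · have h1 := (Submodule.sub_mem_iff_left W (hhigh _ (by omega) (by omega))).mp
      (h12 (a - s) (by omega))
    rwa [Nat.add_sub_cancel' h] at h1
  · exact hhigh a h' ha

/-- For an infinite field `k` of characteristic ≠ 2 and odd `d = 2s+1 ≥ 5`, for general
forms `f₁, f₂, f₃` of degree `d` in `R = k[x,y]` (genericity encoded as the nonvanishing
locus of a nonzero polynomial on the parameter space `k^{3(d+1)}`), with `I = (f₁,f₂,f₃)`,
one has `y^{3s}·f_j ∈ I²` for `j = 1, 2, 3`, i.e. `y^{3s}·I ⊆ I²`. -/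
theorem general_binary_forms_socle_times_I_in_I_sq (k : Type*) [Field k] [Infinite k]
    (h2 : (2 : k) ≠ 0) (s d : ℕ) (hs : 2 ≤ s) (hd : d = 2 * s + 1) :
    ∃ P : MvPolynomial (Fin 3 × Fin (d + 1)) k, P ≠ 0 ∧
      ∀ c : Fin 3 → Fin (d + 1) → k,
        eval (fun p => c p.1 p.2) P ≠ 0 →
          ∀ j : Fin 3,
            (X 1 : MvPolynomial (Fin 2) k) ^ (3 * s) * formOf d (c j) ∈
              (Ideal.span {formOf d (c 0), formOf d (c 1), formOf d (c 2)}) ^ 2 := by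
  subst hd
  have hspan (c : Fin 3 → Fin (2 * s + 1 + 1) → k) :
      (fun j => ∑ b : Fin (5 * s + 2), eval (fun p => c p.1 p.2) (squareMultipleCoeff k s j b) •
        binaryMonomial k s b) = squareMultiple s fun p => formOf (2 * s + 1) (c p) :=
    funext fun j => (squareMultiple_formOf c j).symm
  obtain ⟨P, hP, hmem⟩ := exists_ne_zero_forall_mem_span (linearIndependent_binaryMonomial k s)
    (squareMultipleCoeff k s) (fun p => specialCoeff k s p.1 p.2) (by
      rw [hspan]
      exact fun b => binaryMonomial_mem_span_special k hs b.2)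
  refine ⟨P, hP, fun c hc j => ?_⟩
  have hmem := hmem _ hc
  rw [hspan] at hmem
  set I := Ideal.span {formOf (2 * s + 1) (c 0), formOf (2 * s + 1) (c 1),
    formOf (2 * s + 1) (c 2)} with hI
  have hf (p : Fin 3) : formOf (2 * s + 1) (c p) ∈ I := by
    apply Ideal.subset_span
    fin_cases p <;> simp
  have hle : Submodule.span k (Set.range
      (squareMultiple s fun p => formOf (2 * s + 1) (c p))) ≤ (I ^ 2).restrictScalars k := by
    rw [Submodule.span_le]
    rintro _ ⟨q, rfl⟩
    exact Ideal.mul_mem_left _ _ (sq I ▸ Ideal.mul_mem_mul (hf _) (hf _))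
  rw [formOf, Finset.mul_sum]
  refine Ideal.sum_mem _ fun l _ => ?_
  have hl := l.2
  have hexp : 5 * s + 1 - (l : ℕ) = 3 * s + (2 * s + 1 - l) := by omega
  have hmon : binaryMonomial k s l ∈ I ^ 2 := hle (hmem ⟨l, by omega⟩)
  convert Ideal.mul_mem_left _ (C (c j l)) hmon using 1
  rw [binaryMonomial, hexp]
  ring
end
end
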